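/- (Marginals of the multivariate q-Pólya distribution.) In the multiple q-Pólya urn setup, let 1 ≤ ν ≤ k and let x_1,…,x_ν be nonnegative integers with y_ν = x_1+⋯+x_ν ≤ n. Then Σ p_n(x_1,…,x_ν,x_{ν+1},…,x_k), where the sum is over all nonnegative integers x_{ν+1},…,x_k with x_{ν+1}+⋯+x_k ≤ n−y_ν, equals Q^{Σ_{j=1}^{ν}(n−y_j)(α_j−x_j)} · (∏_{j=1}^{ν}[α_j; x_j]_Q) · [α−α_1−⋯−α_ν; n−y_ν]_Q / [α; n]_Q, i.e. the ν-variate q-Pólya probability function with parameters n, (α_1,…,α_ν), α, and q. -/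

import Mathlib

open Finset Filter

noncomputable def qNum (q x : ℝ) : ℝ := (1 - q ^ x) / (1 - q)

noncomputable def qFact (q x : ℝ) (r : ℕ) : ℝ :=
  ∏ i ∈ Finset.range r, qNum q (x - i)

noncomputable def qFactorial (q : ℝ) (r : ℕ) : ℝ :=
  ∏ i ∈ Finset.range r, qNum q (i + 1)

noncomputable def qBinom (q x : ℝ) (r : ℕ) : ℝ := qFact q x r / qFactorial q r

noncomputable def qMultinom {k : ℕ} (q x : ℝ) (r : Fin k → ℕ) : ℝ :=
  qFact q x (∑ i, r i) / ∏ i, qFactorial q (r i)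

theorem qNum_add {q : ℝ} (hq : 0 < q) (u v : ℝ) : qNum q (u + v) = qNum q u + q ^ u * qNum q v := by
  unfold qNum
  rw [Real.rpow_add hq]
  ring

theorem qNum_zero (q : ℝ) : qNum q 0 = 0 := by simp [qNum]

theorem qNum_natCast_succ_ne_zero {q : ℝ} (hq : 0 < q) (hq1 : q ≠ 1) (n : ℕ) :
    qNum q (n + 1) ≠ 0 := by
  unfold qNum
  refine div_ne_zero (sub_ne_zero.2 fun h => ?_) (sub_ne_zero.2 hq1.symm)
  exact hq1 ((Real.rpow_left_inj hq.le zero_le_one (by positivity : (n : ℝ) + 1 ≠ 0)).1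
    (by rw [← h, Real.one_rpow]))

theorem qBinom_zero (q x : ℝ) : qBinom q x 0 = 1 := by simp [qBinom, qFact, qFactorial]

theorem qBinom_succ_mul {q : ℝ} (hq : 0 < q) (hq1 : q ≠ 1) (x : ℝ) (n : ℕ) :
    qBinom q x (n + 1) * qNum q (n + 1) = qBinom q x n * qNum q (x - n) := by
  have h := qNum_natCast_succ_ne_zero hq hq1 n
  simp only [qBinom, qFact, qFactorial, Finset.prod_range_succ]
  rw [div_mul_eq_mul_div, mul_div_mul_right _ _ h, mul_div_right_comm]

/-- The `q`-Vandermonde convolution with real upper parameters. -/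
theorem qBinom_add {q : ℝ} (hq : 0 < q) (hq1 : q ≠ 1) (a b : ℝ) (N : ℕ) :
    ∑ z ∈ Finset.range (N + 1),
      q ^ (((N : ℝ) - z) * (a - z)) * (qBinom q a z * qBinom q b (N - z)) = qBinom q (a + b) N := by
  induction N with
  | zero => simp [qBinom_zero]
  | succ N ih =>
    refine mul_right_cancel₀ (qNum_natCast_succ_ne_zero hq hq1 N) ?_
    rw [qBinom_succ_mul hq hq1, ← ih, Finset.sum_mul, Finset.sum_mul]
    have split : ∀ z ∈ Finset.range (N + 1 + 1),
        q ^ ((((N + 1 : ℕ) : ℝ) - z) * (a - z)) * (qBinom q a z * qBinom q b (N + 1 - z)) *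
          qNum q (N + 1) =
        q ^ ((((N + 1 : ℕ) : ℝ) - z) * (a - z)) * (qBinom q a z * qBinom q b (N + 1 - z)) *
          qNum q (N + 1 - z) +
        q ^ ((((N + 1 : ℕ) : ℝ) - z) * (a - z)) * (qBinom q a z * qBinom q b (N + 1 - z)) *
          (q ^ ((N : ℝ) + 1 - z) * qNum q z) := by
      intro z _
      rw [← mul_add, ← qNum_add hq, sub_add_cancel]
    rw [Finset.sum_congr rfl split, Finset.sum_add_distrib, Finset.sum_range_succ,
      Finset.sum_range_succ' (fun z : ℕ => q ^ ((((N + 1 : ℕ) : ℝ) - z) * (a - z)) *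
        (qBinom q a z * qBinom q b (N + 1 - z)) * (q ^ ((N : ℝ) + 1 - z) * qNum q z))]
    simp only [Nat.cast_zero, qNum_zero, mul_zero, add_zero, Nat.cast_add, Nat.cast_one, sub_self]
    rw [← Finset.sum_add_distrib]
    refine Finset.sum_congr rfl fun z hz => ?_
    obtain ⟨d, rfl⟩ := Nat.exists_eq_add_of_le (Nat.lt_succ_iff.1 (Finset.mem_range.1 hz))
    have hb := qBinom_succ_mul hq hq1 b d
    have ha := qBinom_succ_mul hq hq1 a z
    rw [show z + d + 1 - z = d + 1 by omega, show z + d + 1 - (z + 1) = d by omega,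
      show z + d - z = d by omega]
    push_cast
    rw [show (z : ℝ) + d + 1 - z = d + 1 by ring, show (z : ℝ) + d + 1 - (z + 1) = d by ring,
      show (z : ℝ) + d - z = d by ring,
      show a + b - ((z : ℝ) + d) = (a - z) + (b - d) by ring, qNum_add hq (a - z),
      show ((d : ℝ) + 1) * (a - z) = d * (a - z) + (a - z) by ring, Real.rpow_add hq,
      show (d : ℝ) * (a - z) = d * (a - (z + 1)) + d by ring, Real.rpow_add hq]
    linear_combination
      (q ^ ((d : ℝ) * (a - (z + 1))) * q ^ (d : ℝ) * q ^ (a - z) * qBinom q a z) * hb +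
      (q ^ ((d : ℝ) * (a - (z + 1))) * q ^ (d : ℝ) * qBinom q b d) * ha

theorem sum_piFinset_const_succ {M : Type*} [AddCommMonoid M] {l : ℕ} (S : Finset ℕ)
    (f : (Fin (l + 1) → ℕ) → M) :
    ∑ z ∈ Fintype.piFinset (fun _ : Fin (l + 1) => S), f z =
      ∑ a ∈ S, ∑ w ∈ Fintype.piFinset (fun _ : Fin l => S), f (Fin.cons a w) := by
  rw [← Finset.sum_product']
  refine (Finset.sum_bij' (fun p _ => Fin.cons p.1 p.2) (fun z _ => (z 0, Fin.tail z))
    ?_ ?_ ?_ ?_ ?_).symm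
  · rintro ⟨a, w⟩ h
    simpa [Fin.forall_fin_succ] using h
  · intro z h
    simpa [Fin.forall_fin_succ, Fin.tail] using h
  · rintro ⟨a, w⟩ _
    simp
  · intro z _
    simp
  · intros
    rfl

/-- The exponent of `Q` in the `q`-Pólya probability function. -/
noncomputable def qPolyaExponent {l : ℕ} (N : ℝ) (β : Fin l → ℝ) (z : Fin l → ℕ) : ℝ :=
  ∑ j : Fin l, (N - ∑ i ∈ Finset.univ.filter (fun i : Fin l => (i : ℕ) ≤ (j : ℕ)), (z i : ℝ)) *
    (β j - z j)

theorem qPolyaExponent_cons {l : ℕ} (N : ℝ) (β : Fin (l + 1) → ℝ) (a : ℕ) (w : Fin l → ℕ) :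
    qPolyaExponent N β (Fin.cons a w : Fin (l + 1) → ℕ) =
      (N - a) * (β 0 - a) + qPolyaExponent (N - a) (fun j => β j.succ) w := by
  simp [qPolyaExponent, Fin.sum_univ_succ, Finset.sum_filter, sub_sub]

theorem qPolyaExponent_append {ν l : ℕ} (N : ℝ) (β : Fin (ν + l) → ℝ) (x : Fin ν → ℕ)
    (z : Fin l → ℕ) :
    qPolyaExponent N β (Fin.append x z) =
      qPolyaExponent N (fun j => β (Fin.castAdd l j)) x +
        qPolyaExponent (N - ∑ i, (x i : ℝ)) (fun j => β (Fin.natAdd ν j)) z := by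
  have h₁ (i : Fin ν) (j : Fin l) : (i : ℕ) ≤ ν + (j : ℕ) := by omega
  have h₂ (i : Fin l) (j : Fin ν) : ¬ ν + (i : ℕ) ≤ (j : ℕ) := by omega
  simp [qPolyaExponent, Fin.sum_univ_add, Finset.sum_filter, sub_sub, h₁, h₂, -Fin.val_fin_le]

/-- The multivariate `q`-Vandermonde convolution. -/
theorem qBinom_sum_add {q : ℝ} (hq : 0 < q) (hq1 : q ≠ 1) {l : ℕ} (β : Fin l → ℝ) (b : ℝ)
    {N M : ℕ} (hNM : N ≤ M) :
    ∑ z ∈ (Fintype.piFinset fun _ : Fin l => Finset.range (M + 1)).filter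
        (fun z => ∑ i, z i ≤ N),
      q ^ qPolyaExponent N β z * ((∏ j, qBinom q (β j) (z j)) * qBinom q b (N - ∑ i, z i)) =
      qBinom q (∑ j, β j + b) N := by
  induction l generalizing N with
  | zero => simp [qPolyaExponent]
  | succ l ih =>
    rw [Finset.sum_filter, sum_piFinset_const_succ, Fin.sum_univ_succ, add_assoc,
      ← qBinom_add hq hq1]
    symm
    refine Finset.sum_subset_zero_on_sdiff (Finset.range_mono (by omega)) ?_ ?_
    · intro a ha
      refine Finset.sum_eq_zero fun w _ => if_neg ?_
      simp only [Finset.mem_sdiff, Finset.mem_range] at ha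
      rw [Fin.sum_cons]
      omega
    · intro a ha
      have haN : a ≤ N := Nat.lt_succ_iff.1 (Finset.mem_range.1 ha)
      rw [← ih (fun j => β j.succ) (show N - a ≤ M by omega), Finset.sum_filter, Finset.mul_sum,
        Finset.mul_sum]
      refine Finset.sum_congr rfl fun w _ => ?_
      rw [Fin.sum_cons, qPolyaExponent_cons, Fin.prod_univ_succ, Nat.cast_sub haN,
        Real.rpow_add hq, Nat.sub_sub]
      by_cases h : a + ∑ i, w i ≤ N
      · rw [if_pos h, if_pos (by omega)]
        simp only [Fin.cons_zero, Fin.cons_succ]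
        ring
      · rw [if_neg h, if_neg (by omega)]
        simp

/-- Marginals of the multivariate `q`-Pólya distribution (Theorem 3.2(a)), stated with
`k = ν + l` colors besides the last: summing the `k`-variate `q`-Pólya probability
function over the last `l` coordinates yields the `ν`-variate `q`-Pólya probability
function with parameters `n`, `(α₁,…,α_ν)`, `α`, `q`.  Here `Q = q^{−m}`,
`α_j = −r_j/m`, `α = −r/m`. -/
theorem multivariate_qPolya_marginal
    (q : ℝ) (hq0 : 0 < q) (hq1 : q ≠ 1)
    (m : ℤ) (hm : m ≠ 0) (ν l : ℕ) (hν : 1 ≤ ν)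
    (r : Fin (ν + l + 1) → ℕ) (hrpos : ∀ j, 0 < r j)
    (n : ℕ) (x : Fin ν → ℕ) (hx : ∑ i, x i ≤ n) :
    (∑ z ∈ (Fintype.piFinset fun _ : Fin l => Finset.range (n + 1)).filter
        (fun z => ∑ i, z i ≤ n - ∑ i, x i),
      ((q ^ (-m)) ^ (∑ j : Fin (ν + l),
            ((n : ℝ) -
                ∑ i ∈ Finset.univ.filter (fun i : Fin (ν + l) => (i : ℕ) ≤ (j : ℕ)),
                  ((Fin.append x z) i : ℝ)) *
              (-(r j.castSucc : ℝ) / (m : ℝ) - (Fin.append x z) j)) *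
        ((∏ j : Fin (ν + l),
            qBinom (q ^ (-m)) (-(r j.castSucc : ℝ) / (m : ℝ)) ((Fin.append x z) j)) *
          qBinom (q ^ (-m)) (-(r (Fin.last (ν + l)) : ℝ) / (m : ℝ))
            (n - ∑ i, (Fin.append x z) i)) /
        qBinom (q ^ (-m)) (-((∑ j, r j : ℕ) : ℝ) / (m : ℝ)) n)) =
    (q ^ (-m)) ^ (∑ j : Fin ν,
        ((n : ℝ) -
            ∑ i ∈ Finset.univ.filter (fun i : Fin ν => (i : ℕ) ≤ (j : ℕ)), (x i : ℝ)) *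
          (-(r (Fin.castSucc (Fin.castAdd l j)) : ℝ) / (m : ℝ) - x j)) *
      ((∏ j : Fin ν, qBinom (q ^ (-m)) (-(r (Fin.castSucc (Fin.castAdd l j)) : ℝ) / (m : ℝ)) (x j)) *
        qBinom (q ^ (-m))
          (-((∑ j, r j : ℕ) : ℝ) / (m : ℝ) -
            ∑ j : Fin ν, (-(r (Fin.castSucc (Fin.castAdd l j)) : ℝ) / (m : ℝ)))
          (n - ∑ i, x i)) /
      qBinom (q ^ (-m)) (-((∑ j, r j : ℕ) : ℝ) / (m : ℝ)) n := by
  have hQ0 : 0 < q ^ (-m) := zpow_pos hq0 _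
  have hQ1 : q ^ (-m) ≠ 1 := fun h => hm (by
    have := (zpow_eq_one_iff_right₀ hq0.le hq1).1 h
    omega)
  generalize q ^ (-m) = Q at hQ0 hQ1 ⊢
  have key := qBinom_sum_add hQ0 hQ1
    (fun j : Fin l => -(r (Fin.castSucc (Fin.natAdd ν j)) : ℝ) / (m : ℝ))
    (-(r (Fin.last (ν + l)) : ℝ) / (m : ℝ)) (Nat.sub_le n (∑ i, x i))
  have hsum : -((∑ j, r j : ℕ) : ℝ) / (m : ℝ) -
      ∑ j : Fin ν, (-(r (Fin.castSucc (Fin.castAdd l j)) : ℝ) / (m : ℝ)) =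
      ∑ j : Fin l, (-(r (Fin.castSucc (Fin.natAdd ν j)) : ℝ) / (m : ℝ)) +
        -(r (Fin.last (ν + l)) : ℝ) / (m : ℝ) := by
    rw [Fin.sum_univ_castSucc, Fin.sum_univ_add, ← Finset.sum_div, ← Finset.sum_div,
      Finset.sum_neg_distrib, Finset.sum_neg_distrib]
    push_cast
    ring
  rw [hsum, ← key, Finset.mul_sum, Finset.mul_sum, Finset.sum_div]
  refine Finset.sum_congr rfl fun z _ => ?_
  have happ := qPolyaExponent_append (n : ℝ)
    (fun j : Fin (ν + l) => -(r j.castSucc : ℝ) / (m : ℝ)) x z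
  rw [← Nat.cast_sum, ← Nat.cast_sub hx] at happ
  simp only [qPolyaExponent] at happ ⊢
  rw [happ, Real.rpow_add hQ0, Fin.prod_univ_add, Fin.sum_univ_add, Nat.sub_sub]
  simp only [Fin.append_left, Fin.append_right]
  ring
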